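/- arXiv:1807.09921 — 3 statements merged into one kernel-verified Lean document; each statement's English description precedes it below -/
import Mathlib

section
/- Let G be a finite group, let A be an abelian normal subgroup of G, and let H be a subgroup of G such that H ∩ A = {e} and G = HA. Then there exist finitely many subgroups H_1, …, H_n of G and one-dimensional characters χ_1, …, χ_n, where χ_i is a character of H_i, such that Ind_H^G 1_H = Σ_{i=1}^n Ind_{H_i}^G χ_i; in particular, every irreducible constituent of Ind_H^G 1_H is a monomial character of G. -/
open scoped Classical

/-- `f : G → ℂ` is the character of some finite-dimensional complex representation of `G`. -/
def IsChar (G : Type) [Group G] (f : G → ℂ) : Prop :=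
  ∃ V : FDRep ℂ G, f = V.character

/-- `f : G → ℂ` is the character of some irreducible (simple) finite-dimensional complex
representation of `G`. -/
def IsIrrChar (G : Type) [Group G] (f : G → ℂ) : Prop :=
  ∃ V : FDRep ℂ G, CategoryTheory.Simple V ∧ f = V.character

/-- Induction of a class function from a subgroup `H` of `G` to `G`:
`(Ind_H^G f)(x) = |H|⁻¹ ∑_{g ∈ G} f̂(g⁻¹ x g)`, where `f̂` agrees with `f` on `H`
and vanishes off `H`. -/
noncomputable def indChar {G : Type} [Group G] [Fintype G] (H : Subgroup G) (f : H → ℂ) :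
    G → ℂ := fun x =>
  (Nat.card H : ℂ)⁻¹ * ∑ g : G, if h : g⁻¹ * x * g ∈ H then f ⟨g⁻¹ * x * g, h⟩ else 0

/-- The usual inner product of class functions on a finite group:
`(f₁, f₂) = |G|⁻¹ ∑_{g ∈ G} f₁(g) conj (f₂ g)`. -/
noncomputable def cfInner (G : Type) [Group G] [Fintype G] (f₁ f₂ : G → ℂ) : ℂ :=
  (Fintype.card G : ℂ)⁻¹ * ∑ g : G, f₁ g * (starRingEnd ℂ) (f₂ g)

/-- The regular character of a finite group `G` (the character of the regular
representation, i.e. `Reg_G = ∑_{χ ∈ Irr G} χ(1)·χ`): it takes the value `|G|` at the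
identity and `0` elsewhere. -/
noncomputable def regChar (G : Type) [Group G] [Fintype G] : G → ℂ :=
  fun g => if g = 1 then (Fintype.card G : ℂ) else 0

/-- The level `l(χ)` of a character of a solvable group: the least `i ≥ 0` such that the
restriction of `χ` to the `i`-th derived subgroup `G^i` equals `χ(1)` times the trivial
character of `G^i`. -/
noncomputable def charLevel (G : Type) [Group G] (χ : G → ℂ) : ℕ :=
  sInf {i : ℕ | ∀ g ∈ derivedSeries G i, χ g = χ 1}


open CategoryTheory in
/-- A nonzero invariant subspace of a simple representation is the whole space. -/
theorem FDRep.eq_top_of_invariant {G : Type} [Group G] (V : FDRep ℂ G) [Simple V]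
    (W : Submodule ℂ V) (hW : ∀ g, W ≤ W.comap (V.ρ g)) (hne : W ≠ ⊥) : W = ⊤ := by
  let σ : Representation ℂ G W :=
    { toFun := fun g => (V.ρ g).restrict (hW g)
      map_one' := by ext; simp
      map_mul' := fun a b => by ext; simp }
  let f : FDRep.of σ ⟶ V :=
    ⟨InducedCategory.homMk (ModuleCat.ofHom W.subtype), fun g => by ext1; rfl⟩
  have : Mono f := by
    constructor
    intro Z a b hab
    ext x
    have := congrArg (fun t => t.hom.hom.hom x) hab
    exact this
  have hf : f ≠ 0 := by
    intro h0
    apply hne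
    rw [Submodule.eq_bot_iff]
    intro w hw
    exact congrArg (fun t => t.hom.hom.hom (⟨w, hw⟩ : W)) h0
  have hiso : IsIso f := (Simple.mono_isIso_iff_nonzero f).2 hf
  rw [Submodule.eq_top_iff']
  intro v
  have h := congrArg (fun t => t.hom.hom.hom v) (IsIso.inv_hom_id f)
  have h' : ((((inv f).hom.hom.hom v : W)) : V) = v := h
  rw [← h']
  exact ((inv f).hom.hom.hom v : W).2

/-- Extension by zero of a function on a subgroup. -/
noncomputable def extendByZero {G : Type} [Group G] (H : Subgroup G) (f : H → ℂ) (y : G) : ℂ :=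
  if h : y ∈ H then f ⟨y, h⟩ else 0

theorem extendByZero_of_mem {G : Type} [Group G] {H : Subgroup G} {f : H → ℂ} {y : G}
    (h : y ∈ H) : extendByZero H f y = f ⟨y, h⟩ := dif_pos h

theorem extendByZero_of_notMem {G : Type} [Group G] {H : Subgroup G} {f : H → ℂ} {y : G}
    (h : y ∉ H) : extendByZero H f y = 0 := dif_neg h

theorem indChar_apply {G : Type} [Group G] [Fintype G] (H : Subgroup G) (f : H → ℂ) (x : G) :
    indChar H f x = (Nat.card H : ℂ)⁻¹ * ∑ g : G, extendByZero H f (g⁻¹ * x * g) := rfl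

theorem sum_extendByZero_mul {G : Type} [Group G] [Fintype G] (H : Subgroup G) (f : H → ℂ)
    (φ : G → ℂ) : ∑ y : G, extendByZero H f y * φ y = ∑ k : H, f k * φ k := by
  classical
  rw [← Finset.sum_subset (Finset.subset_univ (Finset.univ.filter (· ∈ H)))]
  · rw [Finset.sum_subtype (p := (· ∈ H)) _ (by simp)]
    exact Finset.sum_congr rfl fun k _ => by rw [extendByZero_of_mem k.2]
  · intro y _ hy
    rw [extendByZero_of_notMem (by simpa using hy), zero_mul]

/-- Frobenius reciprocity for class functions. -/
theorem cfInner_indChar {G : Type} [Group G] [Fintype G] (H : Subgroup G) (f : H → ℂ)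
    (ψ : G → ℂ) (hψ : ∀ g x, ψ (g * x * g⁻¹) = ψ x) :
    cfInner G (indChar H f) ψ =
      (Nat.card H : ℂ)⁻¹ * ∑ k : H, f k * (starRingEnd ℂ) (ψ k) := by
  have key : ∀ g : G, ∑ x : G, extendByZero H f (g⁻¹ * x * g) * (starRingEnd ℂ) (ψ x) =
      ∑ k : H, f k * (starRingEnd ℂ) (ψ k) := by
    intro g
    rw [← sum_extendByZero_mul H f (fun y => (starRingEnd ℂ) (ψ y)),
      ← (MulAut.conj g).toEquiv.sum_comp]
    refine Finset.sum_congr rfl fun y _ => ?_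
    simp only [MulEquiv.toEquiv_eq_coe, EquivLike.coe_coe, MulAut.conj_apply, hψ]
    congr 2
    group
  have hG : (Fintype.card G : ℂ) ≠ 0 := by simp
  simp only [cfInner, indChar_apply]
  simp only [mul_assoc, Finset.sum_mul, ← Finset.mul_sum]
  rw [Finset.sum_comm]
  simp only [← mul_assoc] at key ⊢
  simp only [key, Finset.sum_const, Finset.card_univ, nsmul_eq_mul]
  field_simp

/-- A linear character of a subgroup, viewed as a function, is a character. -/
theorem isChar_of_monoidHom {K : Type} [Group K] (θ : K →* ℂˣ) :
    IsChar K (fun k => (θ k : ℂ)) := by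
  let σ : Representation ℂ K ℂ :=
    { toFun := fun k => (θ k : ℂ) • LinearMap.id
      map_one' := by ext; simp
      map_mul' := fun a b => by ext; simp [mul_comm] }
  refine ⟨FDRep.of σ, ?_⟩
  funext k
  change _ = LinearMap.trace ℂ ℂ (σ k)
  simp [σ]

/-- A sum over a group of a function that is constant on left cosets of `K`. -/
theorem sum_eq_card_mul_sum_quotient {G : Type} [Group G] [Fintype G] (K : Subgroup G)
    (F : G → ℂ) (hF : ∀ g, ∀ k ∈ K, F (g * k) = F g) :
    ∑ g : G, F g = (Nat.card K : ℂ) * ∑ q : G ⧸ K, F q.out := by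
  have hmem : ∀ g : G, (g : G ⧸ K).out⁻¹ * g ∈ K := fun g =>
    QuotientGroup.eq.1 (QuotientGroup.out_eq' _)
  have h : ∑ p : (G ⧸ K) × K, F (p.1.out * p.2) = ∑ g : G, F g := by
    refine Finset.sum_bij' (fun p _ => p.1.out * p.2)
      (fun g _ => ((g : G ⧸ K), ⟨(g : G ⧸ K).out⁻¹ * g, hmem g⟩)) ?_ ?_ ?_ ?_ ?_
    · simp
    · simp
    · rintro ⟨q, k⟩ _
      have : ((q.out * k : G) : G ⧸ K) = q := by
        rw [QuotientGroup.mk_mul_of_mem _ k.2, QuotientGroup.out_eq']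
      simp [this]
    · simp
    · simp
  rw [← h, Fintype.sum_prod_type, Finset.mul_sum]
  refine Finset.sum_congr rfl fun q _ => ?_
  simp [hF, Nat.card_eq_fintype_card]

/-- A linear character of `K` occurring in the restriction of a representation has an
eigenvector. -/
theorem FDRep.exists_eigenvector {G : Type} [Group G] [Fintype G] (V : FDRep ℂ G)
    (K : Subgroup G) (θ : K →* ℂˣ)
    (hne : ∑ k : K, (θ k : ℂ) * (starRingEnd ℂ) (V.character k) ≠ 0) :
    ∃ v : V, v ≠ 0 ∧ ∀ k : K, V.ρ k v = (θ k : ℂ) • v := by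
  have hconj : ∀ k : K, (starRingEnd ℂ) (θ k : ℂ) = ((θ k)⁻¹ : ℂˣ) := by
    intro k
    have h1 : ‖(θ k : ℂ)‖ = 1 := by
      refine Complex.norm_eq_one_of_pow_eq_one (n := orderOf k) ?_ (orderOf_pos k).ne'
      rw [← Units.val_pow_eq_pow_val, ← map_pow, pow_orderOf_eq_one]
      simp
    rw [Units.val_inv_eq_inv_val, Complex.inv_def, Complex.normSq_eq_norm_sq, h1]
    simp
  let P : V →ₗ[ℂ] V := ∑ k : K, ((θ k)⁻¹ : ℂˣ).val • V.ρ k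
  have hP : P ≠ 0 := by
    intro h0
    apply hne
    have : LinearMap.trace ℂ V P = 0 := by rw [h0, map_zero]
    rw [map_sum] at this
    apply (starRingEnd ℂ).injective
    rw [map_sum, map_zero, ← this]
    refine Finset.sum_congr rfl fun k _ => ?_
    rw [map_mul, hconj, map_smul, smul_eq_mul, Complex.conj_conj]
    rfl
  obtain ⟨w, hw⟩ : ∃ w, P w ≠ 0 := by
    by_contra! h
    exact hP (LinearMap.ext h)
  refine ⟨P w, hw, fun k => ?_⟩
  simp only [P, LinearMap.sum_apply, map_sum, Finset.smul_sum]
  rw [← Equiv.sum_comp (Equiv.mulLeft k)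
    (fun l : K => (θ k : ℂ) • (((θ l)⁻¹ : ℂˣ).val • V.ρ l) w)]
  refine Finset.sum_congr rfl fun l _ => ?_
  simp only [Equiv.coe_mulLeft, map_mul, mul_inv_rev, LinearMap.smul_apply, map_smul, smul_smul,
    Subgroup.coe_mul, Module.End.mul_apply, Units.val_mul, mul_left_comm (θ k : ℂ),
    Units.mul_inv, mul_one]

/-- Joint eigenvectors of commuting operators with distinct systems of eigenvalues are linearly
independent. -/
theorem Module.End.linearIndependent_of_eigenvectors {ι κ V : Type*} [AddCommGroup V] [Module ℂ V]
    (f : ι → Module.End ℂ V) (hf : ∀ i j, Commute (f i) (f j)) (c : κ → ι → ℂ)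
    (hc : Function.Injective c) (b : κ → V) (hb : ∀ q, b q ≠ 0)
    (hfb : ∀ q i, f i (b q) = c q i • b q) : LinearIndependent ℂ b := by
  have h := Module.End.independent_iInf_maxGenEigenspace_of_forall_mapsTo f
    (fun i j φ => Module.End.mapsTo_maxGenEigenspace_of_comm (hf j i) φ)
  refine (h.comp hc).linearIndependent _ (fun q => ?_) hb
  refine (Submodule.mem_iInf _).2 fun i => ?_
  refine (f i).genEigenspace_le_maximal (c q i) 1 ?_
  exact Module.End.mem_genEigenspace_one.2 (hfb q i)

/-- The conjugation action of `G` on the linear characters of a normal subgroup. -/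
noncomputable instance conjMulAction {G : Type} [Group G] (A : Subgroup G) [A.Normal] :
    MulAction G (A →* ℂˣ) where
  smul g χ := χ.comp (MulAut.conjNormal g⁻¹).toMonoidHom
  one_smul χ := by
    change χ.comp (MulAut.conjNormal 1⁻¹).toMonoidHom = χ
    ext; simp
  mul_smul g h χ := by
    change χ.comp (MulAut.conjNormal (g * h)⁻¹).toMonoidHom =
      (χ.comp (MulAut.conjNormal h⁻¹).toMonoidHom).comp (MulAut.conjNormal g⁻¹).toMonoidHom
    ext a
    simp only [MonoidHom.comp_apply, MulEquiv.coe_toMonoidHom, mul_inv_rev, map_mul,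
      MulAut.mul_apply]

section conj

variable {G : Type} [Group G] {A : Subgroup G} [A.Normal]

theorem conj_smul_apply (g : G) (χ : A →* ℂˣ) (a : A) :
    (g • χ) a = χ (MulAut.conjNormal g⁻¹ a) := rfl

theorem conj_smul_eq_of_mem [IsMulCommutative A] {g : G} (hg : g ∈ A) (χ : A →* ℂˣ) :
    g • χ = χ := by
  ext a
  rw [conj_smul_apply]
  congr 2
  ext
  have := congrArg Subtype.val (mul_comm' (⟨g, hg⟩ : A) a)
  simp only [Subgroup.coe_mul] at this
  rw [MulAut.conjNormal_apply, inv_inv, mul_assoc, ← this, inv_mul_cancel_left]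

theorem le_stabilizer [IsMulCommutative A] (χ : A →* ℂˣ) : A ≤ MulAction.stabilizer G χ :=
  fun _ hg => conj_smul_eq_of_mem hg χ

/-- A simple representation containing a linear character of the inertia group of `χ` lying
over `χ` is induced from it. -/
theorem character_eq_indChar_of_cfInner_ne_zero [Fintype G] [IsMulCommutative A] (V : FDRep ℂ G)
    [CategoryTheory.Simple V] (χ : A →* ℂˣ) (K : Subgroup G) (hK : K = MulAction.stabilizer G χ)
    (θ : K →* ℂˣ) (hθ : ∀ (a : A) (h : (a : G) ∈ K), θ ⟨a, h⟩ = χ a)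
    (hne : cfInner G (indChar K (fun k => (θ k : ℂ))) V.character ≠ 0) :
    V.character = indChar K (fun k => (θ k : ℂ)) := by
  have hKmem : ∀ g, g ∈ K ↔ g • χ = χ := fun g => by rw [hK, MulAction.mem_stabilizer_iff]
  have hAK : A ≤ K := hK ▸ le_stabilizer χ
  rw [cfInner_indChar _ _ _ (fun g x => V.char_conj x g)] at hne
  obtain ⟨v, hv, hθv⟩ := V.exists_eigenvector K θ (right_ne_zero_of_mul hne)
  let b : G ⧸ K → V := fun q => V.ρ q.out v
  have hbne : ∀ q, b q ≠ 0 := fun q h => hv (by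
    have := congrArg (V.ρ q.out⁻¹) h
    rwa [map_zero, ← Module.End.mul_apply, ← map_mul, inv_mul_cancel, map_one] at this)
  have hact : ∀ (g : G) (q q' : G ⧸ K) (h : q'.out⁻¹ * (g * q.out) ∈ K),
      V.ρ g (b q) = (θ ⟨_, h⟩ : ℂ) • b q' := by
    intro g q q' h
    rw [← map_smul, ← hθv]
    simp only [b, ← Module.End.mul_apply, ← map_mul]
    congr 2
    group
  have hmem : ∀ (g : G) (q : G ⧸ K), (g • q).out⁻¹ * (g * q.out) ∈ K := by
    intro g q
    rw [← QuotientGroup.eq, QuotientGroup.out_eq', ← smul_eq_mul, MulAction.Quotient.coe_smul_out]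
  have hindep : LinearIndependent ℂ b := by
    refine Module.End.linearIndependent_of_eigenvectors (fun a : A => V.ρ a) ?_
      (fun q a => ((q.out • χ) a : ℂ)) ?_ b hbne ?_
    · intro i j
      change _ * _ = _ * _
      rw [← map_mul, ← map_mul, ← Subgroup.coe_mul, ← Subgroup.coe_mul, mul_comm' i j]
    · intro q q' h
      have h' : q.out • χ = q'.out • χ := by
        ext a
        exact congrFun h a
      rw [← QuotientGroup.out_eq' q, ← QuotientGroup.out_eq' q', QuotientGroup.eq, hKmem,
        mul_smul, ← h', inv_smul_smul]
    · intro q a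
      have hm : q.out⁻¹ * (a * q.out) ∈ A := by
        have := Subgroup.Normal.conj_mem ‹A.Normal› a a.2 q.out⁻¹
        rwa [inv_inv, mul_assoc] at this
      rw [hact a q q (hAK hm), conj_smul_apply, hθ ⟨_, hm⟩ (hAK hm)]
      congr 4
      change _ = q.out⁻¹ * (a : G) * q.out⁻¹⁻¹
      rw [inv_inv, mul_assoc]
  have hspan : Submodule.span ℂ (Set.range b) = ⊤ := by
    refine V.eq_top_of_invariant _ (fun g => ?_) ?_
    · rw [Submodule.span_le]
      rintro _ ⟨q, rfl⟩
      rw [SetLike.mem_coe, Submodule.mem_comap, hact g q (g • q) (hmem g q)]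
      exact Submodule.smul_mem _ _ (Submodule.subset_span ⟨_, rfl⟩)
    · intro h
      have : b (1 : G) ∈ Submodule.span ℂ (Set.range b) := Submodule.subset_span ⟨_, rfl⟩
      rw [h, Submodule.mem_bot] at this
      exact hbne _ this
  let B := Module.Basis.mk hindep hspan.ge
  funext x
  rw [indChar_apply, sum_eq_card_mul_sum_quotient K]
  · rw [inv_mul_cancel_left₀ (by simp)]
    change LinearMap.trace ℂ V (V.ρ x) = _
    rw [LinearMap.trace_eq_matrix_trace ℂ B, Matrix.trace]
    refine Finset.sum_congr rfl fun q _ => ?_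
    rw [Matrix.diag_apply, LinearMap.toMatrix_apply]
    have hB : ∀ q, B q = b q := fun q => by simp [B]
    rw [hB, hact x q (x • q) (hmem x q), map_smul, ← hB, B.repr_self]
    by_cases h : x • q = q
    · have h' : q.out⁻¹ * x * q.out ∈ K := by
        have := hmem x q
        rwa [h, ← mul_assoc] at this
      rw [extendByZero_of_mem h']
      simp [h, mul_assoc]
    · rw [extendByZero_of_notMem]
      · simp [h]
      · intro h'
        apply h
        rw [mul_assoc, ← QuotientGroup.eq, QuotientGroup.out_eq', ← smul_eq_mul,
          MulAction.Quotient.coe_smul_out] at h'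
        exact h'.symm
  · intro g k hk
    have e : (g * k)⁻¹ * x * (g * k) = k⁻¹ * (g⁻¹ * x * g) * k := by group
    rw [e]
    by_cases h : g⁻¹ * x * g ∈ K
    · rw [extendByZero_of_mem h, extendByZero_of_mem (K.mul_mem (K.mul_mem (K.inv_mem hk) h) hk)]
      have : (⟨_, K.mul_mem (K.mul_mem (K.inv_mem hk) h) hk⟩ : K) =
        (⟨k, hk⟩ : K)⁻¹ * ⟨_, h⟩ * ⟨k, hk⟩ := rfl
      rw [this, map_mul, map_mul, map_inv, mul_comm, mul_inv_cancel_left]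
    · rw [extendByZero_of_notMem h, extendByZero_of_notMem]
      intro h'
      apply h
      simpa [mul_assoc] using K.mul_mem (K.mul_mem hk h') (K.inv_mem hk)

end conj

section complement

open Subgroup
open scoped IsMulCommutative

variable {G : Type} [Group G] {A H : Subgroup G}

theorem IsComplement'.snd_mul_right (hc : IsComplement' H A) (a : A) (y : G) :
    (hc.equiv (y * a)).2 = (hc.equiv y).2 * a := by
  rw [IsComplement.equiv_mul_right]

theorem IsComplement'.snd_mul_left (hc : IsComplement' H A) (h : H) (y : G) :
    (hc.equiv (h * y)).2 = (hc.equiv y).2 := by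
  rw [IsComplement.equiv_mul_left]

theorem IsComplement'.snd_coe (hc : IsComplement' H A) (a : A) : (hc.equiv (a : G)).2 = a :=
  Subtype.ext ((hc.equiv_snd_eq_self_iff_mem H.one_mem).2 a.2)

variable [A.Normal]

/-- Conjugation by an element of the complement acts on `A`-components. -/
theorem IsComplement'.snd_conj (hc : IsComplement' H A) (h : H) (y : G) :
    (hc.equiv (h * y * (h : G)⁻¹)).2 = MulAut.conjNormal (h : G) (hc.equiv y).2 := by
  have e : h * y * (h : G)⁻¹ = (h * (hc.equiv y).1 * h⁻¹ : H) *
      (MulAut.conjNormal (h : G) (hc.equiv y).2 : A) := by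
    conv_lhs => rw [← hc.equiv_fst_mul_equiv_snd y]
    rw [Subgroup.coe_mul, Subgroup.coe_mul, Subgroup.coe_inv, MulAut.conjNormal_apply]
    group
  rw [e, IsComplement'.snd_mul_left, IsComplement'.snd_coe]

/-- The `A`-component of a product whose left factor is in `A`. -/
theorem IsComplement'.snd_coe_mul (hc : IsComplement' H A) (a : A) (y : G) :
    (hc.equiv (a * y)).2 = (hc.equiv y).2 * MulAut.conjNormal y⁻¹ a := by
  have : (a : G) * y = y * (MulAut.conjNormal y⁻¹ a : A) := by
    simp [mul_assoc]
  rw [this, IsComplement'.snd_mul_right]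

theorem IsComplement'.apply_snd_conj (hc : IsComplement' H A) (χ : A →* ℂˣ) (b : A) (y : G) :
    χ (hc.equiv (b * y * (b : G)⁻¹)).2 = χ (hc.equiv y).2 * (y • χ * χ⁻¹) b := by
  rw [← Subgroup.coe_inv, IsComplement'.snd_mul_right, IsComplement'.snd_coe_mul]
  simp [conj_smul_apply, mul_assoc]

/-- The extension of `χ : A →* ℂˣ` to its inertia group which is trivial on the complement `H`. -/
noncomputable def extendHom (hc : IsComplement' H A) (χ : A →* ℂˣ) :
    MulAction.stabilizer G χ →* ℂˣ where
  toFun y := χ (hc.equiv y).2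
  map_one' := by
    rw [Subgroup.coe_one, IsComplement.equiv_one _ H.one_mem A.one_mem]
    exact map_one χ
  map_mul' y z := by
    have e : ((y * z : MulAction.stabilizer G χ) : G) =
        (hc.equiv (y : G)).1 * ((hc.equiv (y : G)).2 * z) := by
      rw [← mul_assoc, hc.equiv_fst_mul_equiv_snd, Subgroup.coe_mul]
    have hz : (z : G) • χ = χ := z.2
    rw [e, IsComplement'.snd_mul_left, IsComplement'.snd_coe_mul, map_mul, ← conj_smul_apply, hz,
      mul_comm]

theorem extendHom_apply (hc : IsComplement' H A) (χ : A →* ℂˣ) (y : MulAction.stabilizer G χ) :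
    extendHom hc χ y = χ (hc.equiv (y : G)).2 := rfl

theorem extendHom_coe (hc : IsComplement' H A) (χ : A →* ℂˣ) (a : A)
    (ha : (a : G) ∈ MulAction.stabilizer G χ) : extendHom hc χ ⟨a, ha⟩ = χ a := by
  rw [extendHom_apply, IsComplement'.snd_coe]

/-- The extension by zero of `extendHom hc χ` to `G`. -/
noncomputable def extendHomZero (hc : IsComplement' H A) (χ : A →* ℂˣ) : G → ℂ :=
  extendByZero (MulAction.stabilizer G χ) (fun k => (extendHom hc χ k : ℂ))

theorem extendHomZero_apply (hc : IsComplement' H A) (χ : A →* ℂˣ) (y : G) :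
    extendHomZero hc χ y = if y • χ = χ then (χ (hc.equiv y).2 : ℂ) else 0 := by
  rw [extendHomZero]
  split_ifs with h
  · rw [extendByZero_of_mem (H := MulAction.stabilizer G χ) h]
    rfl
  · exact extendByZero_of_notMem (H := MulAction.stabilizer G χ) h

variable [IsMulCommutative A]

theorem extendHomZero_smul_conj (hc : IsComplement' H A) (χ : A →* ℂˣ) (k y : G) :
    extendHomZero hc (k • χ) (k * y * k⁻¹) = extendHomZero hc χ y := by
  have hH : ∀ (h : H) (ξ : A →* ℂˣ) (z : G),
      extendHomZero hc ((h : G) • ξ) (h * z * (h : G)⁻¹) = extendHomZero hc ξ z := by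
    intro h ξ z
    rw [extendHomZero_apply, extendHomZero_apply, IsComplement'.snd_conj, conj_smul_apply,
      map_inv, MulAut.inv_apply_self, ← mul_smul, inv_mul_cancel_right, mul_smul, smul_left_cancel_iff]
  have hA : ∀ (a : A) (z : G),
      extendHomZero hc χ (a * z * (a : G)⁻¹) = extendHomZero hc χ z := by
    intro a z
    rw [extendHomZero_apply, extendHomZero_apply, IsComplement'.apply_snd_conj, mul_smul, mul_smul,
      conj_smul_eq_of_mem (A.inv_mem a.2), conj_smul_eq_of_mem a.2]
    by_cases h : z • χ = χ <;> simp [h]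
  have e : k * y * k⁻¹ = (hc.equiv k).1 * ((hc.equiv k).2 * y * ((hc.equiv k).2 : G)⁻¹) *
      ((hc.equiv k).1 : G)⁻¹ := by
    conv_lhs => rw [← hc.equiv_fst_mul_equiv_snd k]
    group
  have e' : k • χ = ((hc.equiv k).1 : G) • χ := by
    conv_lhs => rw [← hc.equiv_fst_mul_equiv_snd k]
    rw [mul_smul, conj_smul_eq_of_mem (hc.equiv k).2.2]
  rw [e, e', hH, hA]

theorem indChar_extendHom_smul [Fintype G] (hc : IsComplement' H A) (χ : A →* ℂˣ) (k : G) :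
    indChar (MulAction.stabilizer G (k • χ)) (fun y => (extendHom hc (k • χ) y : ℂ)) =
      indChar (MulAction.stabilizer G χ) (fun y => (extendHom hc χ y : ℂ)) := by
  funext x
  rw [indChar_apply, indChar_apply]
  congr 1
  · rw [MulAction.stabilizer_smul_eq_stabilizer_map_conj]
    rw [Subgroup.card_map_of_injective (MulAut.conj k).injective]
  · rw [← Equiv.sum_comp (Equiv.mulRight k⁻¹)]
    refine Finset.sum_congr rfl fun g _ => ?_
    have e : ((Equiv.mulRight k⁻¹) g)⁻¹ * x * (Equiv.mulRight k⁻¹) g = k * (g⁻¹ * x * g) * k⁻¹ := by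
      simp only [Equiv.coe_mulRight]
      group
    rw [e]
    exact extendHomZero_smul_conj hc χ k _

end complement

theorem MonoidHom.finite_units {A : Type} [CommGroup A] [Finite A] : Finite (A →* ℂˣ) :=
  Finite.of_equiv A (CommGroup.monoidHom_mulEquiv_of_hasEnoughRootsOfUnity A ℂ).some.symm.toEquiv

/-- Column orthogonality for the linear characters of a finite abelian group. -/
theorem MonoidHom.sum_units_apply {A : Type} [CommGroup A] [Finite A] [Fintype (A →* ℂˣ)] (a : A) :
    ∑ χ : A →* ℂˣ, (χ a : ℂ) = if a = 1 then (Nat.card A : ℂ) else 0 := by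
  split_ifs with h
  · subst h
    simp [← CommGroup.card_monoidHom_of_hasEnoughRootsOfUnity A ℂ, Nat.card_eq_fintype_card]
  · obtain ⟨ξ, hξ⟩ := CommGroup.exists_apply_ne_one_of_hasEnoughRootsOfUnity A ℂ h
    have key : (ξ a : ℂ) * ∑ χ : A →* ℂˣ, (χ a : ℂ) = ∑ χ : A →* ℂˣ, (χ a : ℂ) := by
      rw [Finset.mul_sum, ← Equiv.sum_comp (Equiv.mulLeft ξ) (fun χ : A →* ℂˣ => (χ a : ℂ))]
      simp
    by_contra h0
    exact hξ (Units.ext (mul_right_cancel₀ h0 (key.trans (one_mul _).symm)))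

/-- Row orthogonality for the linear characters of a finite abelian group. -/
theorem MonoidHom.sum_apply_units {A : Type} [Group A] [Fintype A] (χ : A →* ℂˣ) :
    ∑ a : A, (χ a : ℂ) = if χ = 1 then (Nat.card A : ℂ) else 0 := by
  have h := sum_hom_units ((Units.coeHom ℂ).comp χ)
  have e : (Units.coeHom ℂ).comp χ = 1 ↔ χ = 1 := by
    constructor
    · intro h
      ext a
      exact DFunLike.congr_fun h a
    · rintro rfl
      ext
      simp
  simpa [e, Nat.card_eq_fintype_card] using h

/-- A sum of an invariant function over a finite set, weighted by the orders of the stabilizers. -/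
theorem MulAction.sum_card_stabilizer_mul {G X : Type*} [Group G] [Finite G] [MulAction G X]
    [Fintype X] [Fintype (MulAction.orbitRel.Quotient G X)] (f : X → ℂ)
    (hf : ∀ (g : G) x, f (g • x) = f x) :
    ∑ x : X, (Nat.card (MulAction.stabilizer G x) : ℂ) * f x =
      (Nat.card G : ℂ) * ∑ ω : MulAction.orbitRel.Quotient G X, f ω.out := by
  classical
  rw [← Equiv.sum_comp (MulAction.selfEquivSigmaOrbits G X).symm, Fintype.sum_sigma,
    Finset.mul_sum]
  refine Finset.sum_congr rfl fun ω _ => ?_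
  have hcard : Nat.card (MulAction.orbit G ω.out) * Nat.card (MulAction.stabilizer G ω.out) =
      Nat.card G := by
    rw [← Nat.card_prod]
    exact Nat.card_congr (MulAction.orbitProdStabilizerEquivGroup G ω.out)
  have h : ∀ y : MulAction.orbit G ω.out,
      (Nat.card (MulAction.stabilizer G ((MulAction.selfEquivSigmaOrbits G X).symm ⟨ω, y⟩)) : ℂ) *
        f ((MulAction.selfEquivSigmaOrbits G X).symm ⟨ω, y⟩) =
      (Nat.card (MulAction.stabilizer G ω.out) : ℂ) * f ω.out := by
    rintro ⟨_, g, rfl⟩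
    change (Nat.card (MulAction.stabilizer G (g • ω.out)) : ℂ) * f (g • ω.out) = _
    rw [hf, MulAction.stabilizer_smul_eq_stabilizer_map_conj,
      Subgroup.card_map_of_injective (MulAut.conj g).injective]
  rw [Finset.sum_congr rfl (fun y _ => h y), Finset.sum_const, Finset.card_univ, nsmul_eq_mul,
    ← mul_assoc, ← hcard, Nat.cast_mul, Nat.card_eq_fintype_card (α := MulAction.orbit G ω.out)]

section complement

open Subgroup
open scoped IsMulCommutative

variable {G : Type} [Group G] [Fintype G] {A H : Subgroup G} [A.Normal] [IsMulCommutative A]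
  [Fintype (A →* ℂˣ)]

theorem sum_extendHomZero (hc : IsComplement' H A) (y : G) :
    ∑ χ : A →* ℂˣ, extendHomZero hc χ y =
      ∑ b : A, extendByZero H (fun _ => 1) (b * y * (b : G)⁻¹) := by
  have hA : (Nat.card A : ℂ) ≠ 0 := by simp
  have h1 : ∀ b : A, (Nat.card A : ℂ) * extendByZero H (fun _ => 1) (b * y * (b : G)⁻¹) =
      ∑ χ : A →* ℂˣ, (χ (hc.equiv (b * y * (b : G)⁻¹)).2 : ℂ) := by
    intro b
    rw [MonoidHom.sum_units_apply]
    have := hc.coe_equiv_snd_eq_one_iff_mem (g := b * y * (b : G)⁻¹) A.one_mem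
    rw [OneMemClass.coe_eq_one] at this
    by_cases h : b * y * (b : G)⁻¹ ∈ H
    · rw [extendByZero_of_mem h, if_pos (this.2 h), mul_one]
    · rw [extendByZero_of_notMem h, if_neg (mt this.1 h), mul_zero]
  apply mul_left_cancel₀ hA
  rw [Finset.mul_sum, Finset.mul_sum, Finset.sum_congr rfl (fun b _ => h1 b), Finset.sum_comm]
  refine Finset.sum_congr rfl fun χ _ => ?_
  simp only [IsComplement'.apply_snd_conj, Units.val_mul]
  rw [← Finset.mul_sum, MonoidHom.sum_apply_units, extendHomZero_apply]
  have h2 : y • χ * χ⁻¹ = 1 ↔ y • χ = χ := by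
    simp only [MonoidHom.ext_iff, MonoidHom.mul_apply, MonoidHom.inv_apply, MonoidHom.one_apply,
      mul_inv_eq_one]
  rw [if_congr h2 rfl rfl]
  split_ifs
  · exact mul_comm _ _
  · simp

/-- The permutation character on the cosets of a complement `H` of an abelian normal subgroup `A`
decomposes according to the `G`-orbits of linear characters of `A`. -/
theorem indChar_one_eq_sum_orbits (hc : IsComplement' H A)
    [Fintype (MulAction.orbitRel.Quotient G (A →* ℂˣ))] :
    indChar H (fun _ => 1) = ∑ ω : MulAction.orbitRel.Quotient G (A →* ℂˣ),
      indChar (MulAction.stabilizer G ω.out) (fun y => (extendHom hc ω.out y : ℂ)) := by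
  funext x
  have hG : (Nat.card G : ℂ) ≠ 0 := by simp
  have hH : (Nat.card H : ℂ) ≠ 0 := by simp
  apply mul_left_cancel₀ hG
  rw [Finset.sum_apply, ← MulAction.sum_card_stabilizer_mul (G := G) (fun χ : A →* ℂˣ =>
    indChar (MulAction.stabilizer G χ) (fun y => (extendHom hc χ y : ℂ)) x)
    (fun g χ => congrFun (indChar_extendHom_smul hc χ g) x)]
  have h1 : ∀ χ : A →* ℂˣ, (Nat.card (MulAction.stabilizer G χ) : ℂ) *
      indChar (MulAction.stabilizer G χ) (fun y => (extendHom hc χ y : ℂ)) x =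
      ∑ g : G, extendHomZero hc χ (g⁻¹ * x * g) := by
    intro χ
    rw [indChar_apply, mul_inv_cancel_left₀ (Nat.cast_ne_zero.2 Nat.card_pos.ne')]
    rfl
  rw [Finset.sum_congr rfl (fun χ _ => h1 χ), Finset.sum_comm,
    Finset.sum_congr rfl (fun g _ => sum_extendHomZero hc (g⁻¹ * x * g)), Finset.sum_comm]
  have h2 : ∀ b : A, ∑ g : G, extendByZero H (fun _ => 1) (b * (g⁻¹ * x * g) * (b : G)⁻¹) =
      ∑ g : G, extendByZero H (fun _ => 1) (g⁻¹ * x * g) := by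
    intro b
    rw [← Equiv.sum_comp (Equiv.mulRight (b : G)⁻¹)
      (fun g : G => extendByZero H (fun _ => 1) (g⁻¹ * x * g))]
    refine Finset.sum_congr rfl fun g _ => ?_
    congr 1
    simp only [Equiv.coe_mulRight]
    group
  rw [Finset.sum_congr rfl (fun b _ => h2 b), indChar_apply, ← hc.card_mul_card]
  simp only [Finset.sum_const, Finset.card_univ, nsmul_eq_mul, Nat.cast_mul,
    Nat.card_eq_fintype_card] at hH ⊢
  field_simp

end complement

/-- If `A` is an abelian normal subgroup of the finite group `G` and `H` is a
subgroup with `H ∩ A = {e}` and `G = HA`, then `Ind_H^G 1_H` is a sum of monomial characters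
`Ind_{H_i}^G χ_i` with each `χ_i` one-dimensional; in particular every irreducible constituent
of `Ind_H^G 1_H` is a monomial character of `G`. -/
theorem induced_trivial_eq_sum_monomial_of_disjoint_compl
    (G : Type) [Group G] [Fintype G]
    (A : Subgroup G) (hAnormal : A.Normal) (hAcomm : ∀ a ∈ A, ∀ b ∈ A, a * b = b * a)
    (H : Subgroup G)
    (hdisj : ∀ g : G, g ∈ H → g ∈ A → g = 1)
    (hprod : ∀ g : G, ∃ h ∈ H, ∃ a ∈ A, g = h * a) :
    ∃ (n : ℕ) (Hs : Fin n → Subgroup G) (χ : (i : Fin n) → (Hs i → ℂ)),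
      (∀ i, IsChar (Hs i) (χ i) ∧ χ i 1 = 1) ∧
      indChar H (fun _ => 1) = ∑ i, indChar (Hs i) (χ i) ∧
      (∀ ψ : G → ℂ, IsIrrChar G ψ → cfInner G (indChar H (fun _ => 1)) ψ ≠ 0 →
        ∃ (K : Subgroup G) (θ : K → ℂ), IsChar K θ ∧ θ 1 = 1 ∧ ψ = indChar K θ) := by
  have := hAnormal
  have : IsMulCommutative A := ⟨⟨fun a b => Subtype.ext (hAcomm a a.2 b b.2)⟩⟩
  have hc : Subgroup.IsComplement' H A := by
    refine Subgroup.isComplement'_of_disjoint_and_mul_eq_univ ?_ ?_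
    · rw [Subgroup.disjoint_def]
      exact fun {g} hgH hgA => hdisj g hgH hgA
    · refine Set.eq_univ_of_forall fun g => ?_
      obtain ⟨h, hh, a, ha, rfl⟩ := hprod g
      exact Set.mul_mem_mul hh ha
  have : Finite (A →* ℂˣ) := by
    open scoped IsMulCommutative in exact MonoidHom.finite_units
  let := Fintype.ofFinite (A →* ℂˣ)
  let := Fintype.ofFinite (MulAction.orbitRel.Quotient G (A →* ℂˣ))
  have hsum := indChar_one_eq_sum_orbits hc
  have hchar : ∀ χ : A →* ℂˣ, IsChar (MulAction.stabilizer G χ)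
      (fun y => (extendHom hc χ y : ℂ)) ∧ (extendHom hc χ 1 : ℂ) = 1 :=
    fun χ => ⟨isChar_of_monoidHom _, by simp⟩
  let e := (Fintype.equivFin (MulAction.orbitRel.Quotient G (A →* ℂˣ))).symm
  refine ⟨_, fun i => MulAction.stabilizer G (e i).out,
    fun i y => (extendHom hc (e i).out y : ℂ), fun i => hchar _, ?_, ?_⟩
  · rw [hsum, ← Equiv.sum_comp e]
  · rintro ψ ⟨V, hV, rfl⟩ hne
    rw [hsum] at hne
    obtain ⟨ω, hω⟩ : ∃ ω : MulAction.orbitRel.Quotient G (A →* ℂˣ),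
        cfInner G (indChar (MulAction.stabilizer G ω.out)
          (fun y => (extendHom hc ω.out y : ℂ))) V.character ≠ 0 := by
      by_contra! h
      apply hne
      simp only [cfInner, Finset.sum_apply, Finset.sum_mul] at h ⊢
      rw [Finset.sum_comm, Finset.mul_sum]
      exact Finset.sum_eq_zero fun ω _ => h ω
    exact ⟨_, _, (hchar ω.out).1, (hchar ω.out).2,
      character_eq_indChar_of_cfInner_ne_zero V ω.out _ rfl _ (extendHom_coe hc ω.out) hω⟩
end

section
/- Let G be a finite group and χ a character of G. Then there exist finitely many cyclic subgroups H_1, …, H_n of G, irreducible (hence one-dimensional) characters ψ_i of H_i, and rational numbers m_1, …, m_n such that χ = Σ_{i=1}^n m_i · Ind_{H_i}^G ψ_i (an equality of class functions on G). -/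
open scoped Classical

/-- The one-dimensional complex representation attached to a linear character. -/
noncomputable def linearFDRep {G : Type} [Group G] (ψ : G →* ℂ) : FDRep ℂ G :=
  FDRep.of (V := ℂ) ((Algebra.lmul ℂ ℂ : ℂ →* Module.End ℂ ℂ).comp ψ)

theorem linearFDRep_character {G : Type} [Group G] (ψ : G →* ℂ) :
    (linearFDRep ψ).character = ψ := by
  funext g
  change LinearMap.trace ℂ ℂ (LinearMap.mulLeft ℂ (ψ g)) = ψ g
  rw [LinearMap.trace_eq_matrix_trace ℂ (Module.Basis.singleton Unit ℂ), Matrix.trace]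
  simp only [Matrix.diag_apply, LinearMap.toMatrix_apply]
  simp

theorem map_mul_map_inv_eq_one {G : Type} [Group G] (ψ : G →* ℂ) (g : G) :
    ψ g * ψ g⁻¹ = 1 := by
  rw [← map_mul, mul_inv_cancel, map_one]

theorem isIrrChar_linear {G : Type} [Group G] [Finite G] (ψ : G →* ℂ) : IsIrrChar G ψ := by
  have := Fintype.ofFinite G
  refine ⟨linearFDRep ψ, ?_, (linearFDRep_character ψ).symm⟩
  rw [FDRep.simple_iff_char_is_norm_one]
  simp only [linearFDRep_character, map_mul_map_inv_eq_one]
  simp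

/-- The linear character of `A` attached to an additive character of `Additive A`. -/
noncomputable def linearOfAddChar {A : Type} [Group A] (φ : AddChar (Additive A) ℂ) : A →* ℂ where
  toFun x := φ (Additive.ofMul x)
  map_one' := by simp
  map_mul' x y := by simp [AddChar.map_add_eq_mul]

/-- The rational algebra of functions generated by the linear characters of `A`. -/
noncomputable def linearCharAlgebra (A : Type) [Group A] : Subalgebra ℚ (A → ℂ) :=
  Algebra.adjoin ℚ (Set.range fun ψ : A →* ℂ => (ψ : A → ℂ))

theorem linear_mem_linearCharAlgebra {A : Type} [Group A] (ψ : A →* ℂ) :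
    (ψ : A → ℂ) ∈ linearCharAlgebra A :=
  Algebra.subset_adjoin ⟨ψ, rfl⟩

theorem toSubmodule_linearCharAlgebra (A : Type) [Group A] :
    Subalgebra.toSubmodule (linearCharAlgebra A) =
      Submodule.span ℚ (Set.range fun ψ : A →* ℂ => (ψ : A → ℂ)) := by
  rw [linearCharAlgebra, Algebra.adjoin_eq_span]
  exact congrArg (fun S : Submonoid (A → ℂ) => Submodule.span ℚ (S : Set (A → ℂ)))
    (Submonoid.closure_eq (MonoidHom.mrange (MonoidHom.coeFn A ℂ)))

theorem sum_linear_apply {A : Type} [CommGroup A] [Fintype A] (x : A) :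
    ∑ φ : AddChar (Additive A) ℂ, linearOfAddChar φ x =
      if x = 1 then (Fintype.card A : ℂ) else 0 := by
  simpa [linearOfAddChar] using AddChar.sum_apply_eq_ite (Additive.ofMul x)

theorem indicator_subgroup_mem_linearCharAlgebra {A : Type} [CommGroup A] [Finite A]
    (B : Subgroup A) : (B : Set A).indicator 1 ∈ linearCharAlgebra A := by
  have := Fintype.ofFinite (A ⧸ B)
  have key : (B : Set A).indicator (1 : A → ℂ) = (Fintype.card (A ⧸ B) : ℚ)⁻¹ •
      ∑ φ : AddChar (Additive (A ⧸ B)) ℂ,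
        ((linearOfAddChar φ).comp (QuotientGroup.mk' B) : A → ℂ) := by
    funext x
    have h := sum_linear_apply (x : A ⧸ B)
    rw [QuotientGroup.eq_one_iff] at h
    have hc : (Fintype.card (A ⧸ B) : ℂ) ≠ 0 := Nat.cast_ne_zero.2 Fintype.card_ne_zero
    simp only [Pi.smul_apply, Finset.sum_apply, MonoidHom.coe_comp, Function.comp_apply,
      QuotientGroup.mk'_apply, h, Rat.smul_def]
    by_cases hx : x ∈ B <;> simp [hx, hc]
  rw [key]
  exact Subalgebra.smul_mem _ (Subalgebra.sum_mem _ fun φ _ => linear_mem_linearCharAlgebra _) _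

/-- The indicator function of the set of generators of a finite abelian group is a rational
combination of linear characters, being the product over the proper subgroups of the
indicators of their complements. -/
theorem indicator_generators_mem_linearCharAlgebra {A : Type} [CommGroup A] [Finite A] :
    {x : A | Subgroup.zpowers x = ⊤}.indicator 1 ∈ linearCharAlgebra A := by
  have := Fintype.ofFinite (Subgroup A)
  have key : {x : A | Subgroup.zpowers x = ⊤}.indicator (1 : A → ℂ) =
      ∏ B : Subgroup A with B ≠ ⊤, (1 - (B : Set A).indicator 1) := by
    funext x
    rw [Finset.prod_apply]
    by_cases hx : Subgroup.zpowers x = ⊤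
    · rw [Set.indicator_of_mem (by exact hx)]
      refine (Finset.prod_eq_one fun B hB => ?_).symm
      have hxB : x ∉ B := fun h => (Finset.mem_filter.1 hB).2
        (top_le_iff.1 (hx ▸ Subgroup.zpowers_le.2 h))
      simp [hxB]
    · rw [Set.indicator_of_notMem (by exact hx)]
      refine (Finset.prod_eq_zero (i := Subgroup.zpowers x) (by simp [hx]) ?_).symm
      simp
  rw [key]
  exact Subalgebra.prod_mem _ fun B _ => Subalgebra.sub_mem _ (Subalgebra.one_mem _)
    (indicator_subgroup_mem_linearCharAlgebra B)

/-- Fourier inversion: a character of a finite abelian group is a combination of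
linear characters. -/
theorem character_mem_linearCharAlgebra {A : Type} [CommGroup A] [Finite A]
    (V : FDRep ℂ A) : V.character ∈ linearCharAlgebra A := by
  have := Fintype.ofFinite A
  have hc : (Fintype.card A : ℂ) ≠ 0 := Nat.cast_ne_zero.2 Fintype.card_ne_zero
  have : Invertible (Nat.card A : ℂ) := invertibleOfNonzero (by simp)
  have key : V.character = ∑ φ : AddChar (Additive A) ℂ,
      (Module.finrank ℂ (linearFDRep (linearOfAddChar φ) ⟶ V) : ℚ) •
        (linearOfAddChar φ : A → ℂ) := by
    funext x
    have hsum (y : A) : ∑ φ : AddChar (Additive A) ℂ,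
        linearOfAddChar φ y⁻¹ * linearOfAddChar φ x =
          if x = y then (Fintype.card A : ℂ) else 0 := by
      simp only [← map_mul, sum_linear_apply, inv_mul_eq_one, eq_comm]
    simp only [Finset.sum_apply, Pi.smul_apply, Rat.smul_def, Rat.cast_natCast,
      ← FDRep.scalar_product_char_eq_finrank_equivariant, linearFDRep_character, mul_assoc,
      Finset.sum_mul]
    rw [← Finset.mul_sum, Finset.sum_comm]
    simp only [← Finset.mul_sum, hsum]
    simp [hc, mul_comm]
  rw [key]
  exact Subalgebra.sum_mem _ fun φ _ => Subalgebra.smul_mem _ (linear_mem_linearCharAlgebra _) _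

/-- Induction of functions from a subgroup as a rational linear map. -/
noncomputable def indCharLinearMap {G : Type} [Group G] [Fintype G] (H : Subgroup G) :
    (H → ℂ) →ₗ[ℚ] (G → ℂ) where
  toFun := indChar H
  map_add' f f' := by
    funext x
    simp only [indChar, Pi.add_apply, ← mul_add, ← Finset.sum_add_distrib]
    congr! 2
    split_ifs <;> simp
  map_smul' c f := by
    funext x
    simp only [indChar, Pi.smul_apply, Rat.smul_def, RingHom.id_apply]
    rw [mul_left_comm, Finset.mul_sum _ _ (c : ℂ)]
    congr! 2
    split_ifs <;> simp

/-- The functions induced from irreducible characters of cyclic subgroups. -/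
def cyclicInducedChars (G : Type) [Group G] [Fintype G] : Set (G → ℂ) :=
  {f | ∃ (H : Subgroup G) (ψ : H → ℂ), IsCyclic H ∧ IsIrrChar H ψ ∧ f = indChar H ψ}

theorem indChar_mem_span_cyclicInducedChars {G : Type} [Group G] [Fintype G] (H : Subgroup G)
    [IsCyclic H] {f : H → ℂ} (hf : f ∈ linearCharAlgebra H) :
    indChar H f ∈ Submodule.span ℚ (cyclicInducedChars G) := by
  rw [← Subalgebra.mem_toSubmodule, toSubmodule_linearCharAlgebra] at hf
  refine (Submodule.span_le (p := (Submodule.span ℚ (cyclicInducedChars G)).comap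
    (indCharLinearMap H))).2 ?_ hf
  rintro _ ⟨ψ, rfl⟩
  exact Submodule.subset_span ⟨H, ψ, inferInstance, isIrrChar_linear ψ, rfl⟩

theorem restrict_mul_indicator_mem_linearCharAlgebra {G : Type} [Group G] [Finite G]
    (V : FDRep ℂ G) (H : Subgroup G) [IsCyclic H] :
    ((fun h : H => V.character h) * {h : H | Subgroup.zpowers h = ⊤}.indicator 1) ∈
      linearCharAlgebra H := by
  let : CommGroup H := IsCyclic.commGroup
  exact Subalgebra.mul_mem _
    (character_mem_linearCharAlgebra (FDRep.of (V := V) (V.ρ.comp H.subtype)))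
    indicator_generators_mem_linearCharAlgebra

/-- A class function is `|G|⁻¹` times the sum over all cyclic subgroups `H` of `|H|` times the
function induced from its restriction to the generators of `H`. -/
theorem eq_sum_indChar_restrict_generators {G : Type} [Group G] [Fintype G] (f : G → ℂ)
    (hf : ∀ g x, f (g⁻¹ * x * g) = f x) :
    f = (Fintype.card G : ℚ)⁻¹ • ∑ H ∈ Finset.univ.filter (fun K : Subgroup G => IsCyclic K),
      (Nat.card H : ℚ) •
        indChar H ((fun h : H => f h) * {h : H | Subgroup.zpowers h = ⊤}.indicator 1) := by
  funext x
  have hG : (Fintype.card G : ℂ) ≠ 0 := Nat.cast_ne_zero.2 Fintype.card_ne_zero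
  have hgen (H : Subgroup G) (y : G) (h : y ∈ H) :
      Subgroup.zpowers (⟨y, h⟩ : H) = ⊤ ↔ Subgroup.zpowers y = H := by
    rw [← (Subgroup.map_injective H.subtype_injective).eq_iff, MonoidHom.map_zpowers,
      ← MonoidHom.range_eq_map, Subgroup.range_subtype]
    rfl
  have hterm (H : Subgroup G) : (Nat.card H : ℂ) *
      indChar H ((fun h : H => f h) * {h : H | Subgroup.zpowers h = ⊤}.indicator 1) x =
      ∑ g : G, if Subgroup.zpowers (g⁻¹ * x * g) = H then f x else 0 := by
    have hH : (Nat.card H : ℂ) ≠ 0 := Nat.cast_ne_zero.2 Nat.card_pos.ne'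
    rw [indChar, mul_inv_cancel_left₀ hH]
    refine Finset.sum_congr rfl fun g _ => ?_
    by_cases h : g⁻¹ * x * g ∈ H
    · simp [h, Set.indicator_apply, hgen, hf]
    · have h' : Subgroup.zpowers (g⁻¹ * x * g) ≠ H :=
        fun e => h (e ▸ Subgroup.mem_zpowers _)
      rw [dif_neg h, if_neg h']
  have hcyc (g : G) : (∑ H ∈ Finset.univ.filter (fun K : Subgroup G => IsCyclic K),
      if Subgroup.zpowers (g⁻¹ * x * g) = H then f x else 0) = f x := by
    rw [Finset.sum_ite_eq, if_pos]
    exact Finset.mem_filter.2 ⟨Finset.mem_univ _, inferInstance⟩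
  simp only [Pi.smul_apply, Finset.sum_apply, Rat.smul_def, Rat.cast_natCast, hterm]
  rw [Finset.sum_comm]
  simp [hcyc, hG]

theorem character_mem_span_cyclicInducedChars {G : Type} [Group G] [Fintype G]
    (V : FDRep ℂ G) : V.character ∈ Submodule.span ℚ (cyclicInducedChars G) := by
  rw [eq_sum_indChar_restrict_generators V.character fun g x => by
    simpa using V.char_conj x g⁻¹]
  refine Submodule.smul_mem _ _ (Submodule.sum_mem _ fun H hH => Submodule.smul_mem _ _ ?_)
  have := (Finset.mem_filter.1 hH).2
  exact indChar_mem_span_cyclicInducedChars H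
    (restrict_mul_indicator_mem_linearCharAlgebra V H)

/-- **weak Brauer / Artin induction.** Every character `χ` of a finite group `G`
is a rational linear combination of characters induced from irreducible (hence
one-dimensional) characters of cyclic subgroups. -/
theorem character_eq_rat_combination_of_induced_from_cyclic
    (G : Type) [Group G] [Fintype G] (χ : G → ℂ) (hχ : IsChar G χ) :
    ∃ (n : ℕ) (Hs : Fin n → Subgroup G) (ψ : (i : Fin n) → (Hs i → ℂ)) (m : Fin n → ℚ),
      (∀ i, IsCyclic (Hs i)) ∧
      (∀ i, IsIrrChar (Hs i) (ψ i)) ∧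
      χ = ∑ i, (m i : ℂ) • indChar (Hs i) (ψ i) := by
  obtain ⟨V, rfl⟩ := hχ
  obtain ⟨n, m, f, hf⟩ := Submodule.mem_span_set'.1 (character_mem_span_cyclicInducedChars V)
  choose Hs ψ hcyc hirr hind using fun i => (f i).2
  refine ⟨n, Hs, ψ, m, hcyc, hirr, hf.symm.trans (Finset.sum_congr rfl fun i _ => ?_)⟩
  rw [hind i, Rat.cast_smul_eq_qsmul]
end

section
/- Let G be a finite group equipped with a weak arithmetic Heilbronn character datum {n(H, φ)}. Then Σ_{χ ∈ Irr(G)} n(G, χ)² ≤ n(G, Reg_G)², where Reg_G = Σ_{χ ∈ Irr(G)} χ(1)·χ is the regular character of G. -/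
open scoped Classical

section Representation

variable {G V : Type} [Group G] [AddCommGroup V] [Module ℂ V]

lemma Subrepresentation.isCompl_toSubmodule {ρ : Representation ℂ G V}
    {p q : Subrepresentation ρ} (h : IsCompl p q) : IsCompl p.toSubmodule q.toSubmodule :=
  ⟨disjoint_iff.2 (congrArg Subrepresentation.toSubmodule h.inf_eq_bot),
    codisjoint_iff.2 (congrArg Subrepresentation.toSubmodule h.sup_eq_top)⟩

variable [FiniteDimensional ℂ V]

lemma IsChar.of_representation (ρ : Representation ℂ G V) : IsChar G ρ.character :=
  ⟨FDRep.of ρ, rfl⟩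

/-- The character of a subrepresentation, as a trace on the ambient space. -/
lemma Subrepresentation.character_eq_trace_comp {ρ : Representation ℂ G V}
    (p : Subrepresentation ρ) (π : V →ₗ[ℂ] p.toSubmodule) (hπ : ∀ x : p.toSubmodule, π x = x)
    (g : G) :
    p.toRepresentation.character g =
      LinearMap.trace ℂ V (ρ g ∘ₗ p.toSubmodule.subtype ∘ₗ π) := by
  rw [← LinearMap.comp_assoc, LinearMap.trace_comp_comm', Representation.character]
  congr 1
  ext x
  have h := hπ (p.toRepresentation g x)
  exact congrArg Subtype.val h.symm

lemma Subrepresentation.character_add_character_of_isCompl {ρ : Representation ℂ G V}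
    {p q : Subrepresentation ρ} (h : IsCompl p.toSubmodule q.toSubmodule) :
    ρ.character = p.toRepresentation.character + q.toRepresentation.character := by
  ext g
  rw [Pi.add_apply,
    p.character_eq_trace_comp (p.toSubmodule.projectionOnto q.toSubmodule h) (by simp),
    q.character_eq_trace_comp (q.toSubmodule.projectionOnto p.toSubmodule h.symm) (by simp),
    ← map_add, Representation.character, ← LinearMap.comp_add]
  congr 1
  ext x
  have := Submodule.projection_add_projection_eq_self h x
  simp only [LinearMap.comp_apply, LinearMap.add_apply]
  conv_lhs => rw [← this]
  rfl

lemma Representation.IsIrreducible.isIrrChar [Fintype G] (ρ : Representation ℂ G V)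
    [ρ.IsIrreducible] : IsIrrChar G ρ.character := by
  have : Invertible (Nat.card G : ℂ) := invertibleOfNonzero (NeZero.ne _)
  refine ⟨FDRep.of ρ, ?_, rfl⟩
  rw [FDRep.simple_iff_char_is_norm_one]
  have h := Representation.char_orthonormal ρ ρ
  rw [if_pos ⟨Representation.Equiv.refl ρ⟩, inv_mul_eq_one₀ (NeZero.ne _)] at h
  exact h.symm

end Representation

section Characters

variable {G : Type} [Group G]

lemma IsIrrChar.isChar {f : G → ℂ} (hf : IsIrrChar G f) : IsChar G f :=
  let ⟨V, _, hV⟩ := hf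
  ⟨V, hV⟩

lemma IsChar.conj_apply {f : G → ℂ} (hf : IsChar G f) (x g : G) :
    f (x * g * x⁻¹) = f g := by
  obtain ⟨V, rfl⟩ := hf
  exact V.char_conj g x

variable [Fintype G]

/-- First orthogonality relation, for irreducible characters viewed as functions. -/
lemma IsIrrChar.card_inv_mul_sum {f f' : G → ℂ} (hf : IsIrrChar G f) (hf' : IsIrrChar G f') :
    (Nat.card G : ℂ)⁻¹ * ∑ g, f g * f' g⁻¹ = if f = f' then 1 else 0 := by
  have : Invertible (Nat.card G : ℂ) := invertibleOfNonzero (NeZero.ne _)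
  obtain ⟨V, hV, rfl⟩ := hf
  obtain ⟨W, hW, rfl⟩ := hf'
  by_cases h : V.character = W.character
  · rw [if_pos h, ← h, FDRep.char_orthonormal, if_pos ⟨CategoryTheory.Iso.refl V⟩]
  · rw [if_neg h, FDRep.char_orthonormal, if_neg]
    rintro ⟨i⟩
    exact h (FDRep.char_iso i)

/-- Complete reducibility, as an induction principle for characters. -/
lemma IsChar.induction {P : (G → ℂ) → Prop} (zero : P 0)
    (irr : ∀ f, IsIrrChar G f → P f)
    (hadd : ∀ f f', IsChar G f → IsChar G f' → P f → P f' → P (f + f'))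
    {f : G → ℂ} (hf : IsChar G f) : P f := by
  have key : ∀ (d : ℕ) (V : Type) [AddCommGroup V] [Module ℂ V] [FiniteDimensional ℂ V]
      (ρ : Representation ℂ G V), Module.finrank ℂ V = d → P ρ.character := by
    intro d
    induction d using Nat.strong_induction_on with
    | _ d ih =>
      intro V _ _ _ ρ hd
      by_cases hV : Subsingleton V
      · convert zero
        ext g
        rw [Representation.character, Subsingleton.elim (ρ g) 0, map_zero, Pi.zero_apply]
      by_cases hirr : ρ.IsIrreducible
      · exact irr _ (Representation.IsIrreducible.isIrrChar ρ)
      have hbt : (⊥ : Submodule ℂ V) ≠ ⊤ := fun h => hV ((Submodule.subsingleton_iff ℂ).1 (subsingleton_of_bot_eq_top h))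
      obtain ⟨p, hp0, hp1⟩ : ∃ p : Subrepresentation ρ, p ≠ ⊥ ∧ p ≠ ⊤ := by
        by_contra! h
        have : Nontrivial (Subrepresentation ρ) :=
          ⟨⊥, ⊤, fun e => hbt (congrArg Subrepresentation.toSubmodule e)⟩
        exact hirr ⟨fun p => or_iff_not_imp_left.2 (h p)⟩
      obtain ⟨q, hpq⟩ := exists_isCompl p
      have hc := Subrepresentation.isCompl_toSubmodule hpq
      have hp1' : p.toSubmodule ≠ ⊤ := fun h => hp1 (Subrepresentation.toSubmodule_injective h)
      have hq1' : q.toSubmodule ≠ ⊤ := fun h => hp0 (Subrepresentation.toSubmodule_injective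
        (by rw [h] at hc; exact disjoint_top.1 hc.disjoint))
      rw [Subrepresentation.character_add_character_of_isCompl hc]
      exact hadd _ _ (.of_representation _) (.of_representation _)
        (ih _ (hd ▸ Submodule.finrank_lt hp1') _ _ rfl)
        (ih _ (hd ▸ Submodule.finrank_lt hq1') _ _ rfl)
  obtain ⟨V, rfl⟩ := hf
  exact key _ V V.ρ rfl

/-- The Heilbronn character `θ = ∑ χ ∈ S, n χ • χ` recovers an additive `n` on all characters,
as soon as `S` contains every irreducible character on which `n` does not vanish. -/
lemma cast_eq_card_inv_mul_sum_heilbronn (n : (G → ℂ) → ℤ)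
    (hadd : ∀ f f' : G → ℂ, IsChar G f → IsChar G f' → n (f + f') = n f + n f')
    (S : Finset (G → ℂ)) (hS : ∀ χ ∈ S, IsIrrChar G χ)
    (hnS : ∀ χ, IsIrrChar G χ → χ ∉ S → n χ = 0) {f : G → ℂ} (hf : IsChar G f) :
    (n f : ℂ) = (Nat.card G : ℂ)⁻¹ * ∑ g, (∑ χ ∈ S, n χ * χ g) * f g⁻¹ := by
  refine hf.induction (P := fun f => (n f : ℂ) =
    (Nat.card G : ℂ)⁻¹ * ∑ g, (∑ χ ∈ S, n χ * χ g) * f g⁻¹) ?_ ?_ ?_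
  · have h0 : IsChar G 0 := by
      have := IsChar.of_representation (1 : Representation ℂ G PUnit)
      convert this
      ext g
      rw [Representation.character, Subsingleton.elim ((1 : Representation ℂ G PUnit) g) 0,
        map_zero, Pi.zero_apply]
    have := hadd 0 0 h0 h0
    rw [add_zero] at this
    have : n 0 = 0 := by omega
    simp [this]
  · intro f hf
    calc (n f : ℂ) = ∑ χ ∈ S, (n χ : ℂ) * if χ = f then 1 else 0 := by
          by_cases h : f ∈ S
          · simp [h]
          · simp [h, hnS f hf h]
      _ = ∑ χ ∈ S, (n χ : ℂ) * ((Nat.card G : ℂ)⁻¹ * ∑ g, χ g * f g⁻¹) :=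
          Finset.sum_congr rfl fun χ hχ => by rw [(hS χ hχ).card_inv_mul_sum hf]
      _ = _ := by
          simp only [Finset.mul_sum, Finset.sum_mul]
          rw [Finset.sum_comm]
          exact Finset.sum_congr rfl fun _ _ => Finset.sum_congr rfl fun _ _ => by ring
  · intro f f' hf hf' h h'
    rw [hadd f f' hf hf', Int.cast_add, h, h', ← mul_add, ← Finset.sum_add_distrib]
    simp [mul_add]

lemma sum_sq_eq_card_inv_mul_sum_heilbronn (n : (G → ℂ) → ℤ)
    (S : Finset (G → ℂ)) (hS : ∀ χ ∈ S, IsIrrChar G χ) :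
    ((∑ χ ∈ S, n χ ^ 2 : ℤ) : ℂ) =
      (Nat.card G : ℂ)⁻¹ * ∑ g, (∑ χ ∈ S, n χ * χ g) * (∑ χ ∈ S, n χ * χ g⁻¹) := by
  calc ((∑ χ ∈ S, n χ ^ 2 : ℤ) : ℂ)
      = ∑ χ ∈ S, ∑ ψ ∈ S, (n χ : ℂ) * n ψ * if χ = ψ then 1 else 0 := by
        push_cast
        refine Finset.sum_congr rfl fun χ hχ => ?_
        simp [hχ, sq]
    _ = ∑ χ ∈ S, ∑ ψ ∈ S, (n χ : ℂ) * n ψ * ((Nat.card G : ℂ)⁻¹ * ∑ g, χ g * ψ g⁻¹) :=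
        Finset.sum_congr rfl fun χ hχ => Finset.sum_congr rfl fun ψ hψ => by
          rw [(hS χ hχ).card_inv_mul_sum (hS ψ hψ)]
    _ = _ := by
        simp only [Finset.mul_sum, Finset.sum_mul]
        rw [Finset.sum_comm (s := S) (t := S), Finset.sum_comm (s := Finset.univ)]
        refine Finset.sum_congr rfl fun χ _ => ?_
        rw [Finset.sum_comm (s := Finset.univ)]
        exact Finset.sum_congr rfl fun _ _ => Finset.sum_congr rfl fun _ _ => by ring

lemma IsChar.of_monoidHom {A : Type} [Group A] (φ : A →* ℂ) : IsChar A φ := by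
  convert IsChar.of_representation
    ((Algebra.lmul ℂ ℂ).toMonoidHom.comp φ : Representation ℂ A ℂ)
  ext a
  exact (Algebra.trace_self_apply (φ a)).symm

end Characters

section Induction

variable {G : Type} [Group G]

/-- The left regular representation on functions. -/
def leftTranslation (G : Type) [Group G] : Representation ℂ G (G → ℂ) where
  toFun g := LinearMap.funLeft ℂ ℂ fun x => g⁻¹ * x
  map_one' := by ext; simp [LinearMap.funLeft]
  map_mul' g h := by ext; simp [LinearMap.funLeft, mul_assoc]

lemma leftTranslation_apply (g : G) (f : G → ℂ) (x : G) :
    leftTranslation G g f x = f (g⁻¹ * x) := rfl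

variable [Fintype G]

/-- Averaging a function on `G` over right translations by `H`, weighted by `φ`. -/
noncomputable def rightAverage (H : Subgroup G) (φ : H →* ℂ) : (G → ℂ) →ₗ[ℂ] (G → ℂ) where
  toFun f x := (Nat.card H : ℂ)⁻¹ * ∑ h : H, φ h * f (x * h)
  map_add' f f' := by ext x; simp [mul_add, Finset.sum_add_distrib]
  map_smul' c f := by
    ext x
    simp only [Pi.smul_apply, smul_eq_mul, RingHom.id_apply, Finset.mul_sum]
    exact Finset.sum_congr rfl fun _ _ => by ring

lemma rightAverage_apply (H : Subgroup G) (φ : H →* ℂ) (f : G → ℂ) (x : G) :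
    rightAverage H φ f x = (Nat.card H : ℂ)⁻¹ * ∑ h : H, φ h * f (x * h) := rfl

lemma rightAverage_leftTranslation (H : Subgroup G) (φ : H →* ℂ) (g : G) (f : G → ℂ) :
    rightAverage H φ (leftTranslation G g f) = leftTranslation G g (rightAverage H φ f) := by
  ext x
  simp [rightAverage_apply, leftTranslation_apply, mul_assoc]

lemma map_mul_rightAverage (H : Subgroup G) (φ : H →* ℂ) (f : G → ℂ) (x : G) (h : H) :
    φ h * rightAverage H φ f (x * h) = rightAverage H φ f x := by
  rw [rightAverage_apply, rightAverage_apply, mul_left_comm, Finset.mul_sum]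
  congr 1
  refine Fintype.sum_equiv (Equiv.mulLeft h) _ _ fun k => ?_
  simp [mul_assoc]

lemma rightAverage_rightAverage (H : Subgroup G) (φ : H →* ℂ) (f : G → ℂ) :
    rightAverage H φ (rightAverage H φ f) = rightAverage H φ f := by
  ext x
  rw [rightAverage_apply H φ (rightAverage H φ f)]
  simp only [map_mul_rightAverage]
  rw [Finset.sum_const, Finset.card_univ, ← Nat.card_eq_fintype_card, nsmul_eq_mul,
    inv_mul_cancel_left₀ (Nat.cast_ne_zero.2 Nat.card_pos.ne')]

/-- The induced representation `Ind_H^G φ`, inside the regular representation. -/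
noncomputable def inducedSubrepresentation (H : Subgroup G) (φ : H →* ℂ) :
    Subrepresentation (leftTranslation G) where
  toSubmodule := LinearMap.range (rightAverage H φ)
  apply_mem_toSubmodule g := by
    rintro _ ⟨f, rfl⟩
    exact ⟨leftTranslation G g f, rightAverage_leftTranslation H φ g f⟩

lemma character_inducedSubrepresentation (H : Subgroup G) (φ : H →* ℂ) :
    (inducedSubrepresentation H φ).toRepresentation.character = indChar H φ := by
  ext g
  rw [Subrepresentation.character_eq_trace_comp _ (rightAverage H φ).rangeRestrict]
  · rw [LinearMap.trace_eq_matrix_trace ℂ (Pi.basisFun ℂ G), Matrix.trace, indChar, Finset.mul_sum]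
    refine Finset.sum_congr rfl fun x _ => ?_
    rw [Matrix.diag_apply, LinearMap.toMatrix_apply, Pi.basisFun_repr, Pi.basisFun_apply]
    change rightAverage H φ (Pi.single x 1) (g⁻¹ * x) = _
    rw [rightAverage_apply]
    congr 1
    by_cases hx : x⁻¹ * g * x ∈ H
    · rw [dif_pos hx, Finset.sum_eq_single ⟨x⁻¹ * g * x, hx⟩]
      · simp [mul_assoc]
      · intro h _ hne
        rw [Pi.single_eq_of_ne, mul_zero]
        intro he
        apply hne
        ext
        simp only
        rw [← mul_right_inj (g⁻¹ * x), he]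
        group
      · simp
    · rw [dif_neg hx]
      refine Finset.sum_eq_zero fun h _ => ?_
      rw [Pi.single_eq_of_ne, mul_zero]
      intro he
      apply hx
      convert h.2
      rw [← mul_right_inj (g⁻¹ * x), he]
      group
  · rintro ⟨_, f, rfl⟩
    exact Subtype.ext (rightAverage_rightAverage H φ f)

lemma isChar_indChar (H : Subgroup G) (φ : H →* ℂ) : IsChar G (indChar H φ) :=
  character_inducedSubrepresentation H φ ▸ .of_representation _

lemma indChar_bot_one : indChar (⊥ : Subgroup G) (1 : (⊥ : Subgroup G) →* ℂ) = regChar G := by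
  ext x
  have h (g : G) : g⁻¹ * x * g = 1 ↔ x = 1 := by
    rw [mul_assoc, inv_mul_eq_one, eq_comm, mul_eq_right]
  simp [indChar, regChar, h]

/-- Frobenius reciprocity. -/
lemma card_inv_mul_sum_mul_indChar (H : Subgroup G) (φ : H →* ℂ) (θ : G → ℂ)
    (hθ : ∀ x g, θ (x * g * x⁻¹) = θ g) :
    (Nat.card G : ℂ)⁻¹ * ∑ g, θ g * indChar H φ g⁻¹ =
      (Nat.card H : ℂ)⁻¹ * ∑ h : H, θ h * φ h⁻¹ := by
  have key (x : G) : (∑ g, θ g * if h : x⁻¹ * g⁻¹ * x ∈ H then φ ⟨x⁻¹ * g⁻¹ * x, h⟩ else 0) =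
      ∑ h : H, θ h * φ h⁻¹ := by
    symm
    refine Fintype.sum_of_injective (fun h : H => x * h * x⁻¹)
      (fun a b hab => by simpa using hab) _ _ (fun g hg => ?_) fun h => ?_
    · rw [dif_neg, mul_zero]
      intro hmem
      exact hg ⟨⟨_, hmem⟩⁻¹, by simp [mul_assoc]⟩
    · have he : x⁻¹ * (x * h * x⁻¹)⁻¹ * x = ((h⁻¹ : H) : G) := by simp [mul_assoc]
      rw [hθ, dif_pos (he ▸ (h⁻¹).2)]
      exact congrArg _ (congrArg φ (Subtype.ext he.symm))
  have : ∑ g, θ g * indChar H φ g⁻¹ =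
      (Nat.card G : ℂ) * ((Nat.card H : ℂ)⁻¹ * ∑ h : H, θ h * φ h⁻¹) := by
    simp only [indChar, mul_left_comm (θ _), ← Finset.mul_sum]
    rw [mul_left_comm]
    congr 1
    simp only [Finset.mul_sum]
    rw [Finset.sum_comm]
    simp only [key]
    simp [Finset.mul_sum]
  rw [this, inv_mul_cancel_left₀ (NeZero.ne _)]

end Induction

lemma exists_finset_monoidHom_sum_eq_ite (A : Type) [Group A] [Finite A] [IsCyclic A] :
    ∃ X : Finset (A →* ℂ), ∀ a : A, ∑ φ ∈ X, φ a = if a = 1 then (Nat.card A : ℂ) else 0 := by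
  let := IsCyclic.commGroup (α := A)
  have := Fintype.ofFinite A
  let toHom : AddChar (Additive A) ℂ ↪ (A →* ℂ) :=
    ⟨fun ψ =>
      { toFun := fun a => ψ (Additive.ofMul a)
        map_one' := ψ.map_zero_eq_one
        map_mul' := fun a b => ψ.map_add_eq_mul (Additive.ofMul a) (Additive.ofMul b) },
      fun ψ ψ' h => AddChar.ext _ _ fun a => DFunLike.congr_fun h a.toMul⟩
  refine ⟨Finset.univ.map toHom, fun a => ?_⟩
  have h := AddChar.sum_apply_eq_ite (α := Additive A) (Additive.ofMul a)
  rw [← Nat.card_eq_fintype_card] at h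
  rw [Finset.sum_map]
  exact h.trans (if_congr ofMul_eq_zero rfl rfl)

lemma norm_monoidHom_apply {A : Type} [Group A] [Finite A] (φ : A →* ℂ) (a : A) : ‖φ a‖ = 1 :=
  Complex.norm_eq_one_of_pow_eq_one (n := Nat.card A)
    (by rw [← map_pow, pow_card_eq_one', map_one]) Nat.card_pos.ne'

lemma fourier_inversion {A : Type} [Group A] [Fintype A] {X : Finset (A →* ℂ)}
    (hX : ∀ a : A, ∑ φ ∈ X, φ a = if a = 1 then (Nat.card A : ℂ) else 0) (θ : A → ℂ) (a : A) :
    ∑ φ ∈ X, ((Nat.card A : ℂ)⁻¹ * ∑ h, θ h * φ h⁻¹) * φ a = θ a := by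
  calc _ = (Nat.card A : ℂ)⁻¹ * ∑ h, θ h * ∑ φ ∈ X, φ (h⁻¹ * a) := by
        simp only [Finset.mul_sum, Finset.sum_mul, map_mul]
        rw [Finset.sum_comm]
        exact Finset.sum_congr rfl fun _ _ => Finset.sum_congr rfl fun _ _ => by ring
    _ = θ a := by
        simp only [hX, inv_mul_eq_one]
        simp
        field_simp

/-- **weak arithmetic Foote–Murty inequality.** For a weak arithmetic Heilbronn
character datum `(nG, n)` on a finite group `G`,
`∑_{χ ∈ Irr G} n(G,χ)² ≤ n(G, Reg_G)²`. -/
theorem weak_arithmetic_foote_murty_inequality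
    (G : Type) [Group G] [Fintype G]
    (nG : (G → ℂ) → ℤ) (n : (H : Subgroup G) → (H → ℂ) → ℤ)
    (haddG : ∀ φ₁ φ₂ : G → ℂ, IsChar G φ₁ → IsChar G φ₂ →
      nG (φ₁ + φ₂) = nG φ₁ + nG φ₂)
    (haddH : ∀ (H : Subgroup G), IsCyclic H → ∀ φ₁ φ₂ : H → ℂ,
      IsChar H φ₁ → IsChar H φ₂ → n H (φ₁ + φ₂) = n H φ₁ + n H φ₂)
    (hind : ∀ (H : Subgroup G), IsCyclic H → ∀ φ : H → ℂ, IsChar H φ →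
      nG (indChar H φ) = n H φ)
    (hnonneg : ∀ (H : Subgroup G), IsCyclic H → ∀ φ : H → ℂ, IsChar H φ → 0 ≤ n H φ) :
    ∑ᶠ χ ∈ {χ : G → ℂ | IsIrrChar G χ}, (nG χ) ^ 2 ≤ (nG (regChar G)) ^ 2 := by
  by_cases hfin : ({χ : G → ℂ | IsIrrChar G χ} ∩ Function.support fun χ => nG χ ^ 2).Finite
  swap
  · rw [finsum_mem_eq_zero_of_infinite hfin]
    positivity
  rw [← finsum_mem_inter_support, finsum_mem_eq_finite_toFinset_sum _ hfin]
  set S := hfin.toFinset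
  have hS : ∀ χ ∈ S, IsIrrChar G χ := fun χ hχ => ((Set.Finite.mem_toFinset hfin).1 hχ).1
  have hnS : ∀ χ, IsIrrChar G χ → χ ∉ S → nG χ = 0 := fun χ hχ h => by
    by_contra h0
    exact h ((Set.Finite.mem_toFinset hfin).2 ⟨hχ, pow_ne_zero 2 h0⟩)
  set θ : G → ℂ := fun g => ∑ χ ∈ S, nG χ * χ g
  have hconj : ∀ x g, θ (x * g * x⁻¹) = θ g := fun x g =>
    Finset.sum_congr rfl fun χ hχ => by rw [(hS χ hχ).isChar.conj_apply]
  have hcoef (H : Subgroup G) (φ : H →* ℂ) :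
      (nG (indChar H φ) : ℂ) = (Nat.card H : ℂ)⁻¹ * ∑ h : H, θ h * φ h⁻¹ := by
    rw [cast_eq_card_inv_mul_sum_heilbronn nG haddG S hS hnS (isChar_indChar H φ)]
    exact card_inv_mul_sum_mul_indChar H φ θ hconj
  have hθ1 : θ 1 = nG (regChar G) := by
    rw [cast_eq_card_inv_mul_sum_heilbronn nG haddG S hS hnS
      (indChar_bot_one (G := G) ▸ isChar_indChar ⊥ 1)]
    change _ = (Nat.card G : ℂ)⁻¹ * ∑ g, θ g * regChar G g⁻¹
    simp [regChar, mul_comm (θ 1)]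
  have hbound (g : G) : ‖θ g‖ ≤ nG (regChar G) := by
    set H := Subgroup.zpowers g
    have hcyc : IsCyclic H := inferInstance
    obtain ⟨X, hX⟩ := exists_finset_monoidHom_sum_eq_ite H
    have hinv (h : H) : θ h = ∑ φ ∈ X, (nG (indChar H φ) : ℂ) * φ h := by
      rw [← fourier_inversion hX (fun h : H => θ h) h]
      exact Finset.sum_congr rfl fun φ _ => by rw [hcoef]
    have hsum : ∑ φ ∈ X, nG (indChar H φ) = nG (regChar G) := by
      have := hinv 1
      simp only [Subgroup.coe_one, hθ1, map_one, mul_one] at this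
      exact_mod_cast this.symm
    calc ‖θ g‖ = ‖∑ φ ∈ X, (nG (indChar H φ) : ℂ) * φ ⟨g, Subgroup.mem_zpowers g⟩‖ := by
          rw [← hinv]
      _ ≤ ∑ φ ∈ X, ‖(nG (indChar H φ) : ℂ) * φ ⟨g, Subgroup.mem_zpowers g⟩‖ := norm_sum_le _ _
      _ = ∑ φ ∈ X, (nG (indChar H φ) : ℝ) := Finset.sum_congr rfl fun φ _ => by
          have h0 : 0 ≤ nG (indChar H φ) := by
            rw [hind H hcyc φ (.of_monoidHom φ)]
            exact hnonneg H hcyc φ (.of_monoidHom φ)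
          rw [norm_mul, norm_monoidHom_apply, mul_one, Complex.norm_intCast, abs_of_nonneg]
          exact_mod_cast h0
      _ = nG (regChar G) := by exact_mod_cast hsum
  have hsq := congrArg norm (sum_sq_eq_card_inv_mul_sum_heilbronn nG S hS)
  have hcard : (0 : ℝ) < Nat.card G := Nat.cast_pos.2 Nat.card_pos
  have hle : ‖∑ g, θ g * θ g⁻¹‖ ≤ Nat.card G * (nG (regChar G) : ℝ) ^ 2 := by
    calc _ ≤ ∑ g, ‖θ g * θ g⁻¹‖ := norm_sum_le _ _
      _ ≤ ∑ _g : G, (nG (regChar G) : ℝ) ^ 2 := Finset.sum_le_sum fun g _ => by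
          rw [norm_mul, sq]
          exact mul_le_mul (hbound _) (hbound _) (norm_nonneg _)
            ((norm_nonneg _).trans (hbound g))
      _ = _ := by simp
  have hreal : ((∑ χ ∈ S, nG χ ^ 2 : ℤ) : ℝ) ≤ (nG (regChar G) : ℝ) ^ 2 := by
    calc ((∑ χ ∈ S, nG χ ^ 2 : ℤ) : ℝ) ≤ ‖((∑ χ ∈ S, nG χ ^ 2 : ℤ) : ℂ)‖ := by
          rw [Complex.norm_intCast]
          exact le_abs_self _
      _ = (Nat.card G : ℝ)⁻¹ * ‖∑ g, θ g * θ g⁻¹‖ := by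
          rw [hsq, norm_mul, norm_inv, Complex.norm_natCast]
      _ ≤ _ := by rwa [inv_mul_le_iff₀ hcard]
  exact_mod_cast hreal
end
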